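/- arXiv:1602.02454 — 2 statements merged into one kernel-verified Lean document; each statement's English description precedes it below -/
import Mathlib

section
/- In the transductive Context-FTPL setup with linear losses, fix a sequence (x^1,ℓ^1),…,(x^T,ℓ^T) of contexts x^τ ∈ X and non-negative loss vectors ℓ^τ ∈ ℝ_{≥0}^K, and for each t let π^t be the smallest (tie-breaking order) minimizer over π ∈ Π of Σ_{τ=1}^{t−1} ⟨π(x^τ), ℓ^τ⟩ + Σ_{x ∈ X} ⟨π(x), ℓ_x⟩. Then the expected regret satisfies: E[ Σ_{t=1}^T ⟨π^t(x^t), ℓ^t⟩ ] − min_{π* ∈ Π} Σ_{t=1}^T ⟨π*(x^t), ℓ^t⟩ ≤ ε·Σ_{t=1}^T E[ ⟨π^t(x^t), ℓ^t⟩² ] + (10/ε)·√(d·m)·log N, where expectations are over the i.i.d. Laplace(ε) perturbation. (Refined regret bound for Context-FTPL with linear losses in the transductive setting, oblivious-adversary form.) -/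
open MeasureTheory Finset

/-- The i.i.d. product Laplace(ε) measure on `ι → ℝ`: density
`z ↦ ∏ i (ε/2)·exp(−ε|z i|)` with respect to Lebesgue measure. -/
noncomputable def laplacePi (ι : Type*) [Fintype ι] (ε : ℝ) :
    MeasureTheory.Measure (ι → ℝ) :=
  (MeasureTheory.volume : MeasureTheory.Measure (ι → ℝ)).withDensity
    fun z => ENNReal.ofReal (∏ i, ε / 2 * Real.exp (-ε * |z i|))

/-- `⟨a, v⟩` for `a ∈ {0,1}^K` (as a Boolean vector) and `v ∈ ℝ^K`. -/
def dotp {K : ℕ} (a : Fin K → Bool) (v : Fin K → ℝ) : ℝ :=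
  ∑ j, if a j then v j else 0

/-- The smallest (in the tie-breaking linear order) minimizer of `c` over the
finite nonempty policy set `P`. -/
noncomputable def argminTie {P : Type*} [Fintype P] [Nonempty P] [LinearOrder P]
    (c : P → ℝ) : P :=
  haveI := Classical.decPred fun p : P => ∀ q, c p ≤ c q
  (Finset.univ.filter fun p : P => ∀ q, c p ≤ c q).min' (by
    obtain ⟨p, -, hp⟩ := Finset.exists_min_image (Finset.univ : Finset P) c
      ⟨Classical.arbitrary P, Finset.mem_univ _⟩
    exact ⟨p, Finset.mem_filter.mpr ⟨Finset.mem_univ _, fun q => hp q (Finset.mem_univ q)⟩⟩)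

theorem integrable_exp_mul_laplace {ε a : ℝ} (ha : |a| < ε) :
    Integrable (fun x : ℝ => ε / 2 * Real.exp (-ε * |x|) * Real.exp (a * x)) := by
  obtain ⟨h1, h2⟩ := abs_lt.1 ha
  rw [← integrableOn_univ, ← Set.Iic_union_Ioi (a := (0 : ℝ))]
  refine IntegrableOn.union ?_ ?_
  · refine IntegrableOn.congr_fun
      ((integrableOn_exp_mul_Iic (a := ε + a) (by linarith) 0).const_mul (ε / 2)) ?_
      measurableSet_Iic
    intro x hx
    simp only [abs_of_nonpos (Set.mem_Iic.1 hx), mul_assoc, ← Real.exp_add]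
    ring_nf
  · refine IntegrableOn.congr_fun
      ((integrableOn_exp_mul_Ioi (a := a - ε) (by linarith) 0).const_mul (ε / 2)) ?_
      measurableSet_Ioi
    intro x hx
    simp only [abs_of_pos (Set.mem_Ioi.1 hx), mul_assoc, ← Real.exp_add]
    ring_nf

theorem integral_exp_mul_laplace {ε a : ℝ} (ha : |a| < ε) :
    ∫ x : ℝ, ε / 2 * Real.exp (-ε * |x|) * Real.exp (a * x) = ε ^ 2 / (ε ^ 2 - a ^ 2) := by
  have hi := integrable_exp_mul_laplace ha
  obtain ⟨h1, h2⟩ := abs_lt.1 ha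
  rw [← intervalIntegral.integral_Iic_add_Ioi (b := 0) hi.integrableOn hi.integrableOn]
  have e1 : ∫ x in Set.Iic (0 : ℝ), ε / 2 * Real.exp (-ε * |x|) * Real.exp (a * x) =
      ∫ x in Set.Iic (0 : ℝ), ε / 2 * Real.exp ((ε + a) * x) := by
    refine setIntegral_congr_fun measurableSet_Iic fun x hx => ?_
    simp only [abs_of_nonpos (Set.mem_Iic.1 hx), mul_assoc, ← Real.exp_add]
    ring_nf
  have e2 : ∫ x in Set.Ioi (0 : ℝ), ε / 2 * Real.exp (-ε * |x|) * Real.exp (a * x) =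
      ∫ x in Set.Ioi (0 : ℝ), ε / 2 * Real.exp ((a - ε) * x) := by
    refine setIntegral_congr_fun measurableSet_Ioi fun x hx => ?_
    simp only [abs_of_pos (Set.mem_Ioi.1 hx), mul_assoc, ← Real.exp_add]
    ring_nf
  rw [e1, e2, integral_const_mul, integral_const_mul, integral_exp_mul_Iic (by linarith),
    integral_exp_mul_Ioi (by linarith)]
  have h3 : ε + a ≠ 0 := by linarith
  have h4 : a - ε ≠ 0 := by linarith
  have h5 : ε ^ 2 - a ^ 2 ≠ 0 := by
    rw [show ε ^ 2 - a ^ 2 = -((ε + a) * (a - ε)) by ring]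
    exact neg_ne_zero.2 (mul_ne_zero h3 h4)
  simp only [mul_zero, Real.exp_zero]
  field_simp
  ring

section LaplacePi

variable {ι : Type*} [Fintype ι] {ε : ℝ}

theorem laplacePi_density_nonneg (hε : 0 < ε) (z : ι → ℝ) :
    0 ≤ ∏ i, ε / 2 * Real.exp (-ε * |z i|) :=
  prod_nonneg fun _ _ => by positivity

theorem measurable_laplacePi_density :
    Measurable fun z : ι → ℝ => ENNReal.ofReal (∏ i, ε / 2 * Real.exp (-ε * |z i|)) := by
  fun_prop

theorem integral_laplacePi (hε : 0 < ε) (g : (ι → ℝ) → ℝ) :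
    ∫ z, g z ∂laplacePi ι ε = ∫ z, (∏ i, ε / 2 * Real.exp (-ε * |z i|)) * g z := by
  rw [laplacePi, integral_withDensity_eq_integral_toReal_smul measurable_laplacePi_density
    (by simp)]
  simp only [ENNReal.toReal_ofReal (laplacePi_density_nonneg hε _), smul_eq_mul]

theorem integrable_laplacePi_iff (hε : 0 < ε) (g : (ι → ℝ) → ℝ) :
    Integrable g (laplacePi ι ε) ↔
      Integrable fun z => (∏ i, ε / 2 * Real.exp (-ε * |z i|)) * g z := by
  rw [laplacePi, integrable_withDensity_iff_integrable_smul' measurable_laplacePi_density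
    (by simp)]
  simp only [ENNReal.toReal_ofReal (laplacePi_density_nonneg hε _), smul_eq_mul]

theorem laplacePi_density_mul_exp (a z : ι → ℝ) :
    (∏ i, ε / 2 * Real.exp (-ε * |z i|)) * Real.exp (∑ i, a i * z i) =
      ∏ i, ε / 2 * Real.exp (-ε * |z i|) * Real.exp (a i * z i) := by
  rw [Real.exp_sum, ← prod_mul_distrib]

theorem integrable_exp_sum_laplacePi (hε : 0 < ε) {a : ι → ℝ} (ha : ∀ i, |a i| < ε) :
    Integrable (fun z => Real.exp (∑ i, a i * z i)) (laplacePi ι ε) := by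
  rw [integrable_laplacePi_iff hε]
  simp only [laplacePi_density_mul_exp]
  exact Integrable.fintype_prod
    (f := fun i x => ε / 2 * Real.exp (-ε * |x|) * Real.exp (a i * x))
    fun i => integrable_exp_mul_laplace (ha i)

theorem integral_exp_sum_laplacePi (hε : 0 < ε) {a : ι → ℝ} (ha : ∀ i, |a i| < ε) :
    ∫ z, Real.exp (∑ i, a i * z i) ∂laplacePi ι ε = ∏ i, ε ^ 2 / (ε ^ 2 - a i ^ 2) := by
  rw [integral_laplacePi hε]
  simp only [laplacePi_density_mul_exp]
  rw [integral_fintype_prod_volume_eq_prod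
    (fun i x => ε / 2 * Real.exp (-ε * |x|) * Real.exp (a i * x))]
  exact prod_congr rfl fun i _ => integral_exp_mul_laplace (ha i)

theorem isProbabilityMeasure_laplacePi (hε : 0 < ε) :
    IsProbabilityMeasure (laplacePi ι ε) := by
  have ha : ∀ i : ι, |(0 : ι → ℝ) i| < ε := fun i => by simpa using hε
  have h1 := integrable_exp_sum_laplacePi hε ha
  have h2 := integral_exp_sum_laplacePi hε ha
  have hε' := hε.ne'
  simp [integrable_const_iff, isFiniteMeasure_iff, hε'] at h1 h2
  rw [measureReal_def] at h2
  exact ⟨(ENNReal.toReal_eq_one_iff _).1 h2⟩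

theorem integrable_sum_mul_laplacePi (hε : 0 < ε) (b : ι → ℝ) :
    Integrable (fun z => ∑ i, b i * z i) (laplacePi ι ε) := by
  classical
  refine integrable_finsetSum _ fun i _ => Integrable.const_mul ?_ _
  have key : ∀ s : ℝ, |s| < ε → Integrable (fun z => Real.exp (s * z i)) (laplacePi ι ε) := by
    intro s hs
    have := integrable_exp_sum_laplacePi hε (a := Pi.single i s) fun j => by
      rcases eq_or_ne j i with rfl | h <;> simp [*]
    simpa [Pi.single_apply, ite_mul] using this
  have hs : |ε / 2| < ε := by rw [abs_of_pos (by positivity)]; linarith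
  refine Integrable.mono' (((key (ε / 2) hs).add (key (-(ε / 2)) (by rwa [abs_neg]))).const_mul
    (2 / ε)) (measurable_pi_apply i).aestronglyMeasurable (Filter.Eventually.of_forall fun z => ?_)
  have h1 := Real.add_one_le_exp (ε / 2 * z i)
  have h2 := Real.add_one_le_exp (-(ε / 2) * z i)
  have h3 := Real.exp_pos (ε / 2 * z i)
  have h4 := Real.exp_pos (-(ε / 2) * z i)
  have h5 : ε / 2 * |z i| ≤ Real.exp (ε / 2 * z i) + Real.exp (-(ε / 2) * z i) := by
    rcases abs_cases (z i) with ⟨h, _⟩ | ⟨h, _⟩ <;> rw [h] <;> linarith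
  rw [Real.norm_eq_abs, Pi.add_apply]
  calc |z i| = 2 / ε * (ε / 2 * |z i|) := by field_simp
    _ ≤ _ := by gcongr

theorem integral_sum_mul_laplacePi (hε : 0 < ε) (b : ι → ℝ) :
    ∫ z, ∑ i, b i * z i ∂laplacePi ι ε = 0 := by
  rw [integral_laplacePi hε]
  have h := integral_neg_eq_self
    (fun z : ι → ℝ => (∏ i, ε / 2 * Real.exp (-ε * |z i|)) * ∑ i, b i * z i) volume
  simp only [Pi.neg_apply, abs_neg, mul_neg, sum_neg_distrib, integral_neg] at h
  linarith

theorem laplacePi_density_sub_ge (hε : 0 < ε) (v z : ι → ℝ) :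
    Real.exp (-ε * ∑ i, |v i|) * ∏ i, ε / 2 * Real.exp (-ε * |z i|) ≤
      ∏ i, ε / 2 * Real.exp (-ε * |(z - v) i|) := by
  rw [mul_sum, Real.exp_sum, ← prod_mul_distrib]
  refine prod_le_prod (fun i _ => by positivity) fun i _ => ?_
  have h : |(z - v) i| ≤ |v i| + |z i| := by
    rw [Pi.sub_apply]; linarith [abs_sub (z i) (v i)]
  rw [mul_left_comm, ← Real.exp_add]
  gcongr
  nlinarith

theorem laplacePi_real_shift (hε : 0 < ε) {S S' : Set (ι → ℝ)} (hS : MeasurableSet S)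
    (hS' : MeasurableSet S') (v : ι → ℝ) (h : ∀ z ∈ S, z - v ∈ S') :
    Real.exp (-ε * ∑ i, |v i|) * (laplacePi ι ε).real S ≤ (laplacePi ι ε).real S' := by
  have := isProbabilityMeasure_laplacePi (ι := ι) hε
  have key : ENNReal.ofReal (Real.exp (-ε * ∑ i, |v i|)) * laplacePi ι ε S ≤
      laplacePi ι ε S' := by
    rw [laplacePi, withDensity_apply _ hS, withDensity_apply _ hS', ← lintegral_indicator hS,
      ← lintegral_indicator hS',
      ← lintegral_const_mul _ (measurable_laplacePi_density.indicator hS)]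
    conv_rhs => rw [← lintegral_sub_right_eq_self _ v]
    refine lintegral_mono fun z => ?_
    by_cases hz : z ∈ S
    · rw [Set.indicator_of_mem hz, Set.indicator_of_mem (h z hz),
        ← ENNReal.ofReal_mul (Real.exp_pos _).le]
      exact ENNReal.ofReal_le_ofReal (laplacePi_density_sub_ge hε v z)
    · simp [hz]
  have := ENNReal.toReal_mono (measure_ne_top _ _) key
  rwa [ENNReal.toReal_mul, ENNReal.toReal_ofReal (Real.exp_pos _).le] at this

end LaplacePi

section ArgminTie

variable {P : Type*} [Fintype P] [Nonempty P] [LinearOrder P]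

theorem argminTie_spec (c : P → ℝ) :
    (∀ q, c (argminTie c) ≤ c q) ∧ ∀ q, (∀ r, c q ≤ c r) → argminTie c ≤ q := by
  let := Classical.decPred fun p : P => ∀ q, c p ≤ c q
  have hmem : argminTie c ∈ univ.filter fun p : P => ∀ q, c p ≤ c q := min'_mem _ _
  exact ⟨(mem_filter.1 hmem).2, fun q hq => min'_le _ _ (mem_filter.2 ⟨mem_univ _, hq⟩)⟩

theorem argminTie_eq_iff (c : P → ℝ) (p : P) :
    argminTie c = p ↔ (∀ q, c p ≤ c q) ∧ ∀ q, q < p → c p < c q := by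
  obtain ⟨h1, h2⟩ := argminTie_spec c
  constructor
  · rintro rfl
    refine ⟨h1, fun q hq => ?_⟩
    by_contra! hc
    exact absurd (h2 q fun r => hc.trans (h1 r)) (not_le.2 hq)
  · rintro ⟨h3, h4⟩
    refine le_antisymm (h2 p h3) ?_
    by_contra! hc
    exact absurd (h1 p) (not_le.2 (h4 _ hc))

theorem argminTie_eq_of_le {c c' : P → ℝ} {p : P} (h : argminTie c = p) (hp : c' p = c p)
    (hq : ∀ q, c q ≤ c' q) : argminTie c' = p := by
  rw [argminTie_eq_iff] at h ⊢
  exact ⟨fun q => hp.trans_le ((h.1 q).trans (hq q)),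
    fun q hlt => hp.trans_lt ((h.2 q hlt).trans_le (hq q))⟩

theorem measurableSet_argminTie_eq {Ω : Type*} [MeasurableSpace Ω] {c : Ω → P → ℝ}
    (hc : ∀ p, Measurable fun z => c z p) (p : P) : MeasurableSet {z | argminTie (c z) = p} := by
  simp only [argminTie_eq_iff, Set.ofPred_and, Set.ofPred_forall]
  exact (MeasurableSet.iInter fun q => measurableSet_le (hc p) (hc q)).inter
    (MeasurableSet.iInter fun q => MeasurableSet.iInter fun _ => measurableSet_lt (hc p) (hc q))

/-- The "be the leader" inequality with a regularizer `w`. -/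
theorem be_the_leader (L : ℕ → P → ℝ) (w : P → ℝ) (T : ℕ) (p : P) :
    ∑ t ∈ range T, L t (argminTie fun q => ∑ τ ∈ range (t + 1), L τ q + w q) +
        w (argminTie fun q => ∑ τ ∈ range 0, L τ q + w q) ≤
      ∑ t ∈ range T, L t p + w p := by
  induction T generalizing p with
  | zero => simpa using (argminTie_spec fun q => ∑ τ ∈ range 0, L τ q + w q).1 p
  | succ T ih =>
    have h := (argminTie_spec fun q => ∑ τ ∈ range (T + 1), L τ q + w q).1 p
    have h' := ih (argminTie fun q => ∑ τ ∈ range (T + 1), L τ q + w q)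
    rw [sum_range_succ]
    simp only [sum_range_succ _ T] at h h' ⊢
    linarith

end ArgminTie

section FiniteRange

theorem comp_eq_sum_indicator {Ω P : Type*} [Fintype P] [DecidableEq P] (A : Ω → P) (g : P → ℝ) (z : Ω) :
    g (A z) = ∑ p, {z | A z = p}.indicator (fun _ => g p) z := by
  simp [Set.indicator_apply]

variable {Ω P : Type*} [MeasurableSpace Ω] [Fintype P] {μ : Measure Ω} [IsFiniteMeasure μ]

theorem integrable_comp_of_finite {A : Ω → P} (hA : ∀ p, MeasurableSet {z | A z = p})
    (g : P → ℝ) : Integrable (fun z => g (A z)) μ := by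
  classical
  simp only [comp_eq_sum_indicator A g]
  exact integrable_finsetSum _ fun p _ => (integrable_const _).indicator (hA p)

theorem integral_comp_of_finite {A : Ω → P} (hA : ∀ p, MeasurableSet {z | A z = p})
    (g : P → ℝ) : ∫ z, g (A z) ∂μ = ∑ p, μ.real {z | A z = p} * g p := by
  classical
  simp only [comp_eq_sum_indicator A g]
  rw [integral_finsetSum _ fun p _ => (integrable_const _).indicator (hA p)]
  exact sum_congr rfl fun p _ => by rw [integral_indicator_const _ (hA p), smul_eq_mul]

end FiniteRange

section Ftpl

variable {ι P : Type*} [Fintype ι] [Fintype P] [Nonempty P] [LinearOrder P] {ε : ℝ}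

/-- The follow-the-perturbed-leader choice after the losses of the first `t` rounds, for the
linear perturbation with coefficients `b`. -/
noncomputable def ftpl (L : ℕ → P → ℝ) (b : P → ι → ℝ) (t : ℕ) (z : ι → ℝ) : P :=
  argminTie fun p => ∑ τ ∈ range t, L τ p + ∑ i, b p i * z i

theorem measurableSet_ftpl_eq (L : ℕ → P → ℝ) (b : P → ι → ℝ) (t : ℕ) (p : P) :
    MeasurableSet {z | ftpl L b t z = p} :=
  measurableSet_argminTie_eq (fun p => by fun_prop) p

theorem ftpl_stability (hε : 0 < ε) {L : ℕ → P → ℝ} {b : P → ι → ℝ} {t : ℕ}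
    (hL : ∀ p, 0 ≤ L t p)
    (hv : ∀ p, ∃ v : ι → ℝ, ∑ i, b p i * v i = L t p ∧ ∑ i, |v i| ≤ L t p ∧
      ∀ q, ∑ i, b q i * v i ≤ L t q) :
    ∫ z, L t (ftpl L b t z) ∂laplacePi ι ε ≤
      ∫ z, L t (ftpl L b (t + 1) z) ∂laplacePi ι ε +
        ε * ∫ z, L t (ftpl L b t z) ^ 2 ∂laplacePi ι ε := by
  have := isProbabilityMeasure_laplacePi (ι := ι) hε
  rw [integral_comp_of_finite (measurableSet_ftpl_eq L b t),
    integral_comp_of_finite (measurableSet_ftpl_eq L b (t + 1)),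
    integral_comp_of_finite (measurableSet_ftpl_eq L b t) fun p => L t p ^ 2, mul_sum,
    ← sum_add_distrib]
  refine sum_le_sum fun p _ => ?_
  obtain ⟨v, hvp, hv1, hvq⟩ := hv p
  have hshift := laplacePi_real_shift hε (measurableSet_ftpl_eq L b t p)
    (measurableSet_ftpl_eq L b (t + 1) p) v fun z hz => by
      refine argminTie_eq_of_le hz ?_ fun q => ?_
      · simp only [Pi.sub_apply, mul_sub, sum_sub_distrib, sum_range_succ, hvp]
        ring
      · simp only [Pi.sub_apply, mul_sub, sum_sub_distrib, sum_range_succ]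
        linarith [hvq q]
  have hexp : 1 - ε * L t p ≤ Real.exp (-ε * ∑ i, |v i|) := by
    have := Real.add_one_le_exp (-ε * ∑ i, |v i|)
    nlinarith
  have hμ : 0 ≤ (laplacePi ι ε).real {z | ftpl L b t z = p} := measureReal_nonneg
  have := mul_le_mul_of_nonneg_right
    ((mul_le_mul_of_nonneg_right hexp hμ).trans hshift) (hL p)
  linarith

theorem integrable_perturbation_ftpl (hε : 0 < ε) (L : ℕ → P → ℝ) (b : P → ι → ℝ) (t : ℕ) :
    Integrable (fun z => ∑ i, b (ftpl L b t z) i * z i) (laplacePi ι ε) := by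
  classical
  have h : ∀ z, ∑ i, b (ftpl L b t z) i * z i =
      ∑ p, {z | ftpl L b t z = p}.indicator (fun z => ∑ i, b p i * z i) z := fun z => by
    simp [Set.indicator_apply]
  simp only [h]
  exact integrable_finsetSum _ fun p _ =>
    (integrable_sum_mul_laplacePi hε (b p)).indicator (measurableSet_ftpl_eq L b t p)

theorem ftpl_regret (hε : 0 < ε) {L : ℕ → P → ℝ} {b : P → ι → ℝ} (hL : ∀ t p, 0 ≤ L t p)
    (hv : ∀ t p, ∃ v : ι → ℝ, ∑ i, b p i * v i = L t p ∧ ∑ i, |v i| ≤ L t p ∧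
      ∀ q, ∑ i, b q i * v i ≤ L t q) (T : ℕ) (p : P) :
    ∫ z, ∑ t ∈ range T, L t (ftpl L b t z) ∂laplacePi ι ε ≤
      ∑ t ∈ range T, L t p + ε * ∑ t ∈ range T, ∫ z, L t (ftpl L b t z) ^ 2 ∂laplacePi ι ε +
        ∫ z, -∑ i, b (ftpl L b 0 z) i * z i ∂laplacePi ι ε := by
  have := isProbabilityMeasure_laplacePi (ι := ι) hε
  have hint : ∀ s t, Integrable (fun z => L s (ftpl L b t z)) (laplacePi ι ε) := fun s t =>
    integrable_comp_of_finite (measurableSet_ftpl_eq L b t) _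
  have hbtl := integral_mono (μ := laplacePi ι ε)
    ((integrable_finsetSum (range T) fun t _ => hint t (t + 1)).add
      (integrable_perturbation_ftpl hε L b 0))
    ((integrable_const (∑ t ∈ range T, L t p)).add (integrable_sum_mul_laplacePi hε (b p)))
    fun z => be_the_leader L (fun q => ∑ i, b q i * z i) T p
  simp only [Pi.add_apply] at hbtl
  rw [integral_add (integrable_finsetSum _ fun t _ => hint t (t + 1))
      (integrable_perturbation_ftpl hε L b 0),
    integral_add (integrable_const _) (integrable_sum_mul_laplacePi hε (b p)),
    integral_sum_mul_laplacePi hε, integral_const, probReal_univ, one_smul, add_zero,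
    integral_finsetSum _ fun t _ => hint t (t + 1)] at hbtl
  have hstab := sum_le_sum fun t (_ : t ∈ range T) => ftpl_stability hε (hL t) (hv t)
  rw [sum_add_distrib, ← mul_sum] at hstab
  rw [integral_finsetSum _ fun t _ => hint t t, integral_neg]
  linarith

theorem integral_exp_neg_perturbation_le (hε : 0 < ε) {b : ι → ℝ} {n : ℝ} (hn : 1 ≤ n)
    (hb : ∀ i, b i = 0 ∨ b i = 1) (hbn : ∑ i, b i ≤ n) :
    Integrable (fun z => Real.exp (-(ε / (2 * √n) * ∑ i, b i * z i))) (laplacePi ι ε) ∧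
      ∫ z, Real.exp (-(ε / (2 * √n) * ∑ i, b i * z i)) ∂laplacePi ι ε ≤ Real.exp (1 / 3) := by
  have hsq : √n ^ 2 = n := Real.sq_sqrt (by linarith)
  have hs1 : 1 ≤ √n := Real.one_le_sqrt.2 hn
  set a : ι → ℝ := fun i => -(ε / (2 * √n) * b i) with ha
  have hlt : ε / (2 * √n) < ε := by
    rw [div_lt_iff₀ (by positivity)]; nlinarith
  have hab : ∀ i, |a i| < ε := fun i => by
    rcases hb i with h | h
    · simpa [ha, h] using hε
    · simpa [ha, h, abs_of_pos (show 0 < ε / (2 * √n) by positivity)] using hlt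
  have hrw : ∀ z : ι → ℝ, -(ε / (2 * √n) * ∑ i, b i * z i) = ∑ i, a i * z i := fun z => by
    rw [mul_sum, ← sum_neg_distrib]
    exact sum_congr rfl fun i _ => by rw [ha]; ring
  simp only [hrw]
  refine ⟨integrable_exp_sum_laplacePi hε hab, ?_⟩
  rw [integral_exp_sum_laplacePi hε hab]
  have hfac : ∀ i, ε ^ 2 / (ε ^ 2 - a i ^ 2) ≤ Real.exp (b i / (3 * n)) := fun i => by
    rcases hb i with h | h
    · simp [ha, h, hε.ne']
    · have h1 : a i ^ 2 = ε ^ 2 / (4 * n) := by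
        simp only [ha, h, mul_one, neg_sq, div_pow, mul_pow, hsq]; norm_num
      have h2 : 0 < 4 * n - 1 := by linarith
      have h3 : ε ^ 2 / (ε ^ 2 - a i ^ 2) = 1 / (4 * n - 1) + 1 := by
        have h4 : ε ^ 2 - a i ^ 2 = ε ^ 2 * (4 * n - 1) / (4 * n) := by
          rw [h1]; field_simp
        rw [h4]
        field_simp
        ring
      rw [h3, h]
      refine le_trans ?_ (Real.add_one_le_exp _)
      gcongr
      linarith
  refine (prod_le_prod (fun i _ => ?_) fun i _ => hfac i).trans ?_
  · have : a i ^ 2 < ε ^ 2 := sq_lt_sq' (neg_lt_of_abs_lt (hab i)) (lt_of_abs_lt (hab i))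
    exact div_nonneg (sq_nonneg _) (by linarith)
  · rw [← Real.exp_sum, ← sum_div]
    refine Real.exp_le_exp.2 ?_
    rw [div_le_div_iff₀ (by linarith) (by norm_num)]
    linarith

theorem integral_neg_perturbation_le (hε : 0 < ε) {b : P → ι → ℝ} {n : ℝ} (hn : 1 ≤ n)
    (hb : ∀ p i, b p i = 0 ∨ b p i = 1) (hbn : ∀ p, ∑ i, b p i ≤ n) (L : ℕ → P → ℝ) (t : ℕ) :
    ∫ z, -∑ i, b (ftpl L b t z) i * z i ∂laplacePi ι ε ≤
      2 * √n / ε * (Real.log (Fintype.card P) + 1 / 3) := by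
  have := isProbabilityMeasure_laplacePi (ι := ι) hε
  have hs : 0 < √n := Real.sqrt_pos.2 (by linarith)
  have hN : (0 : ℝ) < Fintype.card P := by exact_mod_cast Fintype.card_pos
  set N : ℝ := (Fintype.card P : ℝ) with hNdef
  set D : ℝ := N * Real.exp (1 / 3) with hD
  have hDpos : 0 < D := by positivity
  set c : ℝ := Real.log N + 1 / 3 with hc
  have hDc : Real.exp c = D := by rw [hc, Real.exp_add, Real.exp_log hN]
  set s : ℝ := ε / (2 * √n) with hsdef
  have hspos : 0 < s := by positivity
  have hE := fun p => integral_exp_neg_perturbation_le hε hn (hb p) (hbn p)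
  have hpt : ∀ z : ι → ℝ, s * -∑ i, b (ftpl L b t z) i * z i ≤
      (c - 1) + D⁻¹ * ∑ p, Real.exp (-(s * ∑ i, b p i * z i)) := fun z => by
    set y := s * ∑ i, b (ftpl L b t z) i * z i with hy
    have h1 := Real.add_one_le_exp (-y - c)
    rw [Real.exp_sub, hDc] at h1
    have h2 : Real.exp (-y) ≤ ∑ p, Real.exp (-(s * ∑ i, b p i * z i)) :=
      single_le_sum (f := fun p => Real.exp (-(s * ∑ i, b p i * z i)))
        (fun p _ => (Real.exp_pos _).le) (mem_univ (ftpl L b t z))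
    have h3 : Real.exp (-y) / D ≤ D⁻¹ * ∑ p, Real.exp (-(s * ∑ i, b p i * z i)) := by
      rw [div_eq_inv_mul]; gcongr
    rw [mul_neg]
    linarith
  have hint : Integrable (fun z => ∑ p, Real.exp (-(s * ∑ i, b p i * z i))) (laplacePi ι ε) :=
    integrable_finsetSum _ fun p _ => (hE p).1
  have hmono := integral_mono (μ := laplacePi ι ε)
    ((integrable_perturbation_ftpl hε L b t).neg.const_mul s)
    ((integrable_const (c - 1)).add (hint.const_mul D⁻¹)) hpt
  simp only [Pi.add_apply, Pi.neg_apply] at hmono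
  rw [integral_add (integrable_const _) (hint.const_mul _), integral_const, probReal_univ,
    one_smul, integral_const_mul, integral_const_mul,
    integral_finsetSum _ fun p _ => (hE p).1] at hmono
  have hsum : ∑ p, ∫ z, Real.exp (-(s * ∑ i, b p i * z i)) ∂laplacePi ι ε ≤ D :=
    (sum_le_sum fun p _ => (hE p).2).trans (by simp [hD, hNdef])
  have hone : D⁻¹ * ∑ p, ∫ z, Real.exp (-(s * ∑ i, b p i * z i)) ∂laplacePi ι ε ≤ 1 :=
    (mul_le_mul_of_nonneg_left hsum (by positivity)).trans (inv_mul_cancel₀ hDpos.ne').le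
  have hfin := hmono.trans (show _ ≤ c by linarith)
  have h2 : 2 * √n / ε = s⁻¹ := by rw [hsdef, inv_div]
  rw [h2, ← div_eq_inv_mul, le_div_iff₀ hspos]
  linarith

end Ftpl

theorem dotp_eq_sum_mul {K : ℕ} (a : Fin K → Bool) (v : Fin K → ℝ) :
    dotp a v = ∑ j, (if a j then 1 else 0) * v j := by
  simp [dotp]

theorem dotp_nonneg {K : ℕ} (a : Fin K → Bool) {v : Fin K → ℝ} (hv : ∀ j, 0 ≤ v j) :
    0 ≤ dotp a v :=
  sum_nonneg fun j _ => by split_ifs <;> simp [hv j]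

/-- **Refined regret bound for Context-FTPL with non-negative linear losses,
transductive setting (oblivious-adversary form).**  With `π^t` the tie-broken
minimizer of the perturbed cumulative loss of the first `t` rounds (same
i.i.d. Laplace(ε) perturbation at every round), the expected regret is at most
`ε·∑_t E[⟨π^t(x^t), ℓ^t⟩²] + (10/ε)·√(dm)·log N`. -/
theorem context_ftpl_regret_transductive_linear
    {X P : Type*} [Fintype X] [Fintype P] [Nonempty P] [LinearOrder P]
    {K m d N : ℕ} (hK : 1 ≤ K) (hm : 1 ≤ m)
    (hd : Fintype.card X = d) (hN : Fintype.card P = N) (hN2 : 2 ≤ N)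
    (pol : P → X → Fin K → Bool)
    (hsparse : ∀ p x, (Finset.univ.filter fun j => pol p x j = true).card ≤ m)
    {ε : ℝ} (hε : 0 < ε)
    (T : ℕ) (xs : ℕ → X) (ℓ : ℕ → Fin K → ℝ) (hℓ : ∀ τ j, 0 ≤ ℓ τ j) :
    (∫ z, (∑ t ∈ Finset.range T,
          dotp (pol (argminTie fun p : P =>
            (∑ τ ∈ Finset.range t, dotp (pol p (xs τ)) (ℓ τ)) +
              ∑ xc : X, dotp (pol p xc) fun j => z (xc, j)) (xs t)) (ℓ t))
        ∂(laplacePi (X × Fin K) ε)) -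
      (Finset.univ.inf' Finset.univ_nonempty fun p : P =>
        ∑ t ∈ Finset.range T, dotp (pol p (xs t)) (ℓ t)) ≤
      ε * (∑ t ∈ Finset.range T,
          ∫ z, (dotp (pol (argminTie fun p : P =>
            (∑ τ ∈ Finset.range t, dotp (pol p (xs τ)) (ℓ τ)) +
              ∑ xc : X, dotp (pol p xc) fun j => z (xc, j)) (xs t)) (ℓ t)) ^ 2
            ∂(laplacePi (X × Fin K) ε)) +
        10 / ε * Real.sqrt ((d : ℝ) * (m : ℝ)) * Real.log N := by
  classical
  subst hd hN
  set b : P → X × Fin K → ℝ := fun p i => if pol p i.1 i.2 then 1 else 0 with hb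
  set L : ℕ → P → ℝ := fun t p => dotp (pol p (xs t)) (ℓ t) with hLdef
  have hpert : ∀ (p : P) (z : X × Fin K → ℝ),
      ∑ xc : X, dotp (pol p xc) (fun j => z (xc, j)) = ∑ i, b p i * z i := fun p z => by
    rw [Fintype.sum_prod_type]
    exact sum_congr rfl fun x _ => dotp_eq_sum_mul _ _
  have hftpl : ∀ (t : ℕ) (z : X × Fin K → ℝ),
      (argminTie fun p : P => (∑ τ ∈ range t, dotp (pol p (xs τ)) (ℓ τ)) +
        ∑ xc : X, dotp (pol p xc) fun j => z (xc, j)) = ftpl L b t z := fun t z => by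
    simp only [hpert]; rfl
  simp only [hftpl]
  have hL : ∀ t p, 0 ≤ L t p := fun t p => dotp_nonneg _ (hℓ t)
  have hv : ∀ t p, ∃ v : X × Fin K → ℝ, ∑ i, b p i * v i = L t p ∧ ∑ i, |v i| ≤ L t p ∧
      ∀ q, ∑ i, b q i * v i ≤ L t q := fun t p => by
    refine ⟨fun i => if i.1 = xs t then (if pol p (xs t) i.2 then ℓ t i.2 else 0) else 0,
      ?_, le_of_eq ?_, fun q => ?_⟩
    · rw [Fintype.sum_prod_type, Fintype.sum_eq_single (xs t) fun x hx => by simp [hx]]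
      exact sum_congr rfl fun j _ => by by_cases h : pol p (xs t) j <;> simp [hb, h]
    · rw [Fintype.sum_prod_type, Fintype.sum_eq_single (xs t) fun x hx => by simp [hx]]
      exact sum_congr rfl fun j _ => by
        by_cases h : pol p (xs t) j <;> simp [h, abs_of_nonneg (hℓ t j)]
    · rw [Fintype.sum_prod_type, Fintype.sum_eq_single (xs t) fun x hx => by simp [hx]]
      exact sum_le_sum fun j _ => by
        by_cases h : pol p (xs t) j <;> by_cases h' : pol q (xs t) j <;> simp [hb, h, h', hℓ t j]
  have hn : (1 : ℝ) ≤ (Fintype.card X : ℝ) * m := by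
    have : 0 < Fintype.card X := Fintype.card_pos_iff.2 ⟨xs 0⟩
    exact_mod_cast Nat.mul_pos this hm
  have hbn : ∀ p, ∑ i, b p i ≤ (Fintype.card X : ℝ) * m := fun p => by
    rw [Fintype.sum_prod_type, ← nsmul_eq_mul]
    refine sum_le_card_nsmul _ _ _ fun x _ => ?_
    simp only [hb, sum_boole]
    exact_mod_cast hsparse p x
  obtain ⟨p, -, hp⟩ := exists_mem_eq_inf' (univ_nonempty (α := P))
    fun p => ∑ t ∈ range T, L t p
  have hreg := ftpl_regret hε hL hv T p
  have hpb := integral_neg_perturbation_le hε hn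
    (fun p i => (ite_eq_or_eq _ _ _).symm) hbn L 0
  have hlog : Real.log 2 ≤ Real.log (Fintype.card P) :=
    Real.log_le_log (by norm_num) (by exact_mod_cast hN2)
  have hfac : 0 ≤ 2 * √((Fintype.card X : ℝ) * m) / ε := by positivity
  have hbound : 2 * √((Fintype.card X : ℝ) * m) / ε * (Real.log (Fintype.card P) + 1 / 3) ≤
      10 / ε * √((Fintype.card X : ℝ) * m) * Real.log (Fintype.card P) := by
    calc _ ≤ 2 * √((Fintype.card X : ℝ) * m) / ε * (5 * Real.log (Fintype.card P)) := by
          gcongr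
          linarith [Real.log_two_gt_d9]
      _ = _ := by ring
  rw [hp]
  linarith
end

section
/- In the transductive Context-FTPL setup with predictors, fix a sequence (x^1,f^1),…,(x^T,f^T) of contexts x^t ∈ X and loss functions f^t : {0,1}^K → ℝ and predictors Q^1,…,Q^T : {0,1}^K → ℝ. For each t, with the same perturbation draw, let π^t be the smallest (tie-breaking order) minimizer over π ∈ Π of Σ_{τ=1}^{t−1} f^τ(π(x^τ)) + Q^t(π(x^t)) + Σ_{x ∈ X} ⟨π(x), ℓ_x⟩ and let ρ^t be the smallest minimizer over π ∈ Π of Σ_{τ=1}^{t} f^τ(π(x^τ)) + Σ_{x ∈ X} ⟨π(x), ℓ_x⟩; set a^t := π^t(x^t), b^t := ρ^t(x^t), ΔQ^t := f^t − Q^t. Then E[ ΔQ^t(a^t) − ΔQ^t(b^t) ] ≤ 4·ε·K·‖f^t − Q^t‖_*², where the expectation is over the i.i.d. Laplace(ε) perturbation. (Lemma: Stability with Predictors, transductive setting.) -/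
open MeasureTheory Finset

/-- `‖f‖_* = max_{a ∈ {0,1}^K} |f a|` for a loss function `f`. -/
noncomputable def dualNorm {K : ℕ} (f : (Fin K → Bool) → ℝ) : ℝ :=
  Finset.univ.sup' ⟨fun _ => false, Finset.mem_univ _⟩ fun a => |f a|

theorem argminTie_le {P : Type*} [Fintype P] [Nonempty P] [LinearOrder P]
    (c : P → ℝ) (q : P) : c (argminTie c) ≤ c q := by
  let _ := Classical.decPred fun p : P => ∀ q, c p ≤ c q
  have h : argminTie c ∈ Finset.univ.filter fun p : P => ∀ q, c p ≤ c q := Finset.min'_mem _ _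
  exact (Finset.mem_filter.mp h).2 q

theorem abs_le_dualNorm {K : ℕ} (f : (Fin K → Bool) → ℝ) (a : Fin K → Bool) :
    |f a| ≤ dualNorm f :=
  Finset.le_sup' (fun a => |f a|) (Finset.mem_univ a)

/-- The Laplace(ε) distribution on `ℝ`. -/
noncomputable def laplaceMeasure (ε : ℝ) : Measure ℝ :=
  volume.withDensity fun z => ENNReal.ofReal (ε / 2 * Real.exp (-ε * |z|))

theorem integral_laplace_density {ε : ℝ} (hε : 0 < ε) :
    ∫ z : ℝ, ε / 2 * Real.exp (-ε * |z|) = 1 := by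
  rw [integral_comp_abs (f := fun z => ε / 2 * Real.exp (-ε * z)), integral_const_mul,
    integral_exp_mul_Ioi (by linarith)]
  simp
  field_simp

theorem integrable_laplace_density {ε : ℝ} (hε : 0 < ε) :
    Integrable fun z : ℝ => ε / 2 * Real.exp (-ε * |z|) :=
  Integrable.of_integral_ne_zero (by rw [integral_laplace_density hε]; exact one_ne_zero)

theorem isProbabilityMeasure_laplaceMeasure {ε : ℝ} (hε : 0 < ε) :
    IsProbabilityMeasure (laplaceMeasure ε) := by
  constructor
  rw [laplaceMeasure, withDensity_apply _ MeasurableSet.univ, Measure.restrict_univ,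
    ← ofReal_integral_eq_lintegral_ofReal (integrable_laplace_density hε)
      (.of_forall fun z => by positivity), integral_laplace_density hε, ENNReal.ofReal_one]

theorem laplaceMeasure_le {ε : ℝ} (hε : 0 < ε) :
    laplaceMeasure ε ≤ ENNReal.ofReal (ε / 2) • volume := by
  rw [laplaceMeasure, ← withDensity_const]
  refine withDensity_mono (.of_forall fun z => ENNReal.ofReal_le_ofReal ?_)
  refine mul_le_of_le_one_right (by positivity) (Real.exp_le_one_iff.mpr ?_)
  nlinarith [abs_nonneg z]

theorem laplacePi_eq_pi (ι : Type*) [Fintype ι] {ε : ℝ} (hε : 0 < ε) :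
    laplacePi ι ε = Measure.pi fun _ => laplaceMeasure ε := by
  have := isProbabilityMeasure_laplaceMeasure hε
  refine (Measure.pi_eq fun s hs => ?_).symm
  have hint (i : ι) := (integrable_laplace_density hε).restrict (s := s i)
  rw [laplacePi, withDensity_apply _ (.univ_pi hs), volume_pi, Measure.restrict_pi_pi,
    ← ofReal_integral_eq_lintegral_ofReal (Integrable.fintype_prod hint)
      (.of_forall fun z => Finset.prod_nonneg fun i _ => by positivity),
    integral_fintype_prod_eq_prod (f := fun _ z => ε / 2 * Real.exp (-ε * |z|)),
    ENNReal.ofReal_prod_of_nonneg fun i _ => integral_nonneg fun z => by positivity]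
  refine Finset.prod_congr rfl fun i _ => ?_
  rw [laplaceMeasure, withDensity_apply _ (hs i),
    ofReal_integral_eq_lintegral_ofReal (hint i) (.of_forall fun z => by positivity)]

/-- If every section of `s` in the coordinate `i` has measure at most `c`, so has `s`. -/
theorem measure_pi_le_of_section_le {ι : Type*} [Fintype ι] [DecidableEq ι] {μ : ι → Measure ℝ}
    [∀ i, IsProbabilityMeasure (μ i)] {s : Set (ι → ℝ)} (hs : MeasurableSet s) (i : ι)
    {c : ENNReal} (h : ∀ x, μ i {y | Function.update x i y ∈ s} ≤ c) :
    Measure.pi μ s ≤ c := by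
  have hm : Measurable (s.indicator (1 : (ι → ℝ) → ENNReal)) := measurable_one.indicator hs
  rw [← lintegral_indicator_one hs, lintegral_eq_lmarginal_univ (fun _ => 0),
    lmarginal_erase' _ hm (Finset.mem_univ i)]
  refine (lmarginal_mono (g := fun _ => c) (fun x => ?_) _).trans (by simp [lmarginal])
  refine le_trans (le_of_eq ?_) (h x)
  exact lintegral_indicator_one (hs.preimage (measurable_update x))

/-- Adding the shift `s` to the cost of the points marked by `β`, minimizers of `u` and of `v`
can disagree on `β` only for `s` in a set of length at most twice the distance of `u` and `v`. -/
theorem volume_disagreement_le {P : Type*} {u v : P → ℝ} {γ : ℝ}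
    (huv : ∀ p, |v p - u p| ≤ γ) (β : P → Bool) :
    volume {s : ℝ | ∃ p q, β p ≠ β q ∧
      (∀ r, u p + (if β p then s else 0) ≤ u r + (if β r then s else 0)) ∧
      (∀ r, v q + (if β q then s else 0) ≤ v r + (if β r then s else 0))} ≤
      ENNReal.ofReal (2 * γ) := by
  refine (Real.volume_le_diam _).trans (Metric.ediam_le ?_)
  rintro s ⟨p, q, hne, hp, hq⟩ s' ⟨p', q', hne', hp', hq'⟩
  rw [edist_dist]
  refine ENNReal.ofReal_le_ofReal ?_
  rw [Real.dist_eq, abs_le]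
  have a1 := hp p'
  have a2 := hp q'
  have a3 := hq p'
  have a4 := hq q'
  have a5 := hp' p
  have a6 := hp' q
  have a7 := hq' p
  have a8 := hq' q
  have b1 := abs_le.mp (huv p)
  have b2 := abs_le.mp (huv q)
  have b3 := abs_le.mp (huv p')
  have b4 := abs_le.mp (huv q')
  cases h1 : β p <;> cases h2 : β q <;> cases h3 : β p' <;> cases h4 : β q' <;>
    simp_all <;> constructor <;> linarith

/-- For costs `u` and `v` at distance at most `γ`, minimizers of the perturbed costs
disagree in the coordinate `i` with probability at most `ε γ`. -/
theorem laplacePi_disagreement_le {P ι : Type*} [Finite P] [Fintype ι] {ε : ℝ} (hε : 0 < ε)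
    {u v : P → ℝ} {γ : ℝ} (huv : ∀ p, |v p - u p| ≤ γ) (β : P → ι → Bool) (i : ι) :
    laplacePi ι ε {z | ∃ p q, β p i ≠ β q i ∧
      (∀ r, u p + ∑ k, (if β p k then z k else 0) ≤ u r + ∑ k, (if β r k then z k else 0)) ∧
      (∀ r, v q + ∑ k, (if β q k then z k else 0) ≤ v r + ∑ k, (if β r k then z k else 0))} ≤
      ENNReal.ofReal (ε * γ) := by
  classical
  have := isProbabilityMeasure_laplaceMeasure hε
  have hcont (p : P) : Measurable fun z : ι → ℝ => ∑ k, (if β p k then z k else 0) :=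
    Finset.measurable_fun_sum _ fun k _ => by split_ifs <;> fun_prop
  rw [laplacePi_eq_pi ι hε]
  refine measure_pi_le_of_section_le ?_ i fun x => ?_
  · refine Measurable.setOf (.exists fun p => .exists fun q => measurable_const.and
      (.and (.forall fun r => ?_) (.forall fun r => ?_)))
    · exact measurableSet_setOfPred.mp (measurableSet_le ((hcont p).const_add _) ((hcont r).const_add _))
    · exact measurableSet_setOfPred.mp (measurableSet_le ((hcont q).const_add _) ((hcont r).const_add _))
  · have hsplit (p : P) (y : ℝ) :
        ∑ k, (if β p k then Function.update x i y k else 0) =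
          ∑ k ∈ Finset.univ.erase i, (if β p k then x k else 0) + if β p i then y else 0 := by
      rw [← Finset.sum_erase_add _ _ (Finset.mem_univ i), Function.update_self]
      congr 1
      refine Finset.sum_congr rfl fun k hk => ?_
      rw [Function.update_of_ne (Finset.ne_of_mem_erase hk)]
    simp only [Set.mem_ofPred_eq, hsplit, ← add_assoc]
    refine (laplaceMeasure_le hε _).trans ?_
    rw [Measure.smul_apply, smul_eq_mul]
    grw [volume_disagreement_le (γ := γ) (fun p => by simpa using huv p) (fun p => β p i)]
    rw [← ENNReal.ofReal_mul (by positivity)]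
    exact ENNReal.ofReal_le_ofReal (by linarith)

/-- If `a` and `b` differ in each coordinate with probability at most `c`, then the expected
difference of `g` along them is at most `2 K c` times the norm of `g`. -/
theorem integral_sub_le_of_disagreement_le {Ω : Type*} [MeasurableSpace Ω] {μ : Measure Ω} {K : ℕ}
    (g : (Fin K → Bool) → ℝ) (a b : Ω → Fin K → Bool) {c : ℝ} (hc : 0 ≤ c)
    (h : ∀ j, μ {ω | a ω j ≠ b ω j} ≤ ENNReal.ofReal c) :
    ∫ ω, (g (a ω) - g (b ω)) ∂μ ≤ 2 * dualNorm g * (K * c) := by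
  have hγ : 0 ≤ dualNorm g := (abs_nonneg _).trans (abs_le_dualNorm g fun _ => false)
  have hpt (ω : Ω) : ENNReal.ofReal ‖g (a ω) - g (b ω)‖ ≤
      (⋃ j, {ω | a ω j ≠ b ω j}).indicator (fun _ => ENNReal.ofReal (2 * dualNorm g)) ω := by
    by_cases hab : a ω = b ω
    · simp [hab]
    · rw [Set.indicator_of_mem (Set.mem_iUnion.mpr (Function.ne_iff.mp hab))]
      refine ENNReal.ofReal_le_ofReal ((norm_sub_le _ _).trans ?_)
      linarith [abs_le_dualNorm g (a ω), abs_le_dualNorm g (b ω), Real.norm_eq_abs (g (a ω)),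
        Real.norm_eq_abs (g (b ω))]
  have hunion : μ (⋃ j, {ω | a ω j ≠ b ω j}) ≤ ENNReal.ofReal (K * c) := by
    refine (measure_iUnion_fintype_le μ _).trans ((Finset.sum_le_sum fun j _ => h j).trans ?_)
    simp [ENNReal.ofReal_mul]
  refine (Real.le_norm_self _).trans ((norm_integral_le_lintegral_norm _).trans
    (ENNReal.toReal_le_of_le_ofReal (by positivity) ?_))
  refine (lintegral_mono hpt).trans ((lintegral_indicator_const_le _ _).trans ?_)
  grw [hunion]
  rw [← ENNReal.ofReal_mul (by positivity)]

/-- **Stability with Predictors (transductive setting).**  With the same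
i.i.d. Laplace(ε) perturbation draw, let `π^t` be the tie-broken minimizer of
`∑_{τ<t} f^τ(p(x^τ)) + Q^t(p(x^t)) + ∑_x ⟨p(x), ℓ_x⟩` and `ρ^t` the
tie-broken minimizer of `∑_{τ≤t} f^τ(p(x^τ)) + ∑_x ⟨p(x), ℓ_x⟩`, and set
`ΔQ^t = f^t − Q^t`, `a^t = π^t(x^t)`, `b^t = ρ^t(x^t)`.  Then
`E[ΔQ^t(a^t) − ΔQ^t(b^t)] ≤ 4·ε·K·‖f^t − Q^t‖_*²`. -/
theorem stability_with_predictors_transductive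
    {X P : Type*} [Fintype X] [Fintype P] [Nonempty P] [LinearOrder P]
    {K m d N : ℕ} (hK : 1 ≤ K) (hm : 1 ≤ m)
    (hd : Fintype.card X = d) (hN : Fintype.card P = N) (hN2 : 2 ≤ N)
    (pol : P → X → Fin K → Bool)
    (hsparse : ∀ p x, (Finset.univ.filter fun j => pol p x j = true).card ≤ m)
    {ε : ℝ} (hε : 0 < ε)
    (T : ℕ) (xs : ℕ → X) (f Q : ℕ → (Fin K → Bool) → ℝ) (t : ℕ) (ht : t < T) :
    (∫ z,
        ((f t (pol (argminTie fun p : P =>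
              (∑ τ ∈ Finset.range t, f τ (pol p (xs τ))) + Q t (pol p (xs t)) +
                ∑ xc : X, dotp (pol p xc) fun j => z (xc, j)) (xs t)) -
            Q t (pol (argminTie fun p : P =>
              (∑ τ ∈ Finset.range t, f τ (pol p (xs τ))) + Q t (pol p (xs t)) +
                ∑ xc : X, dotp (pol p xc) fun j => z (xc, j)) (xs t))) -
          (f t (pol (argminTie fun p : P =>
              (∑ τ ∈ Finset.range (t + 1), f τ (pol p (xs τ))) +
                ∑ xc : X, dotp (pol p xc) fun j => z (xc, j)) (xs t)) -
            Q t (pol (argminTie fun p : P =>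
              (∑ τ ∈ Finset.range (t + 1), f τ (pol p (xs τ))) +
                ∑ xc : X, dotp (pol p xc) fun j => z (xc, j)) (xs t))))
        ∂(laplacePi (X × Fin K) ε)) ≤
      4 * ε * (K : ℝ) * dualNorm (fun a => f t a - Q t a) ^ 2 := by
  set γ := dualNorm fun a => f t a - Q t a
  have hγ0 : 0 ≤ γ := (abs_nonneg _).trans
    (abs_le_dualNorm (fun a => f t a - Q t a) fun _ => false)
  set u : P → ℝ := fun p => (∑ τ ∈ Finset.range t, f τ (pol p (xs τ))) + Q t (pol p (xs t)) with hu
  set v : P → ℝ := fun p => ∑ τ ∈ Finset.range (t + 1), f τ (pol p (xs τ)) with hv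
  have huv (p : P) : |v p - u p| ≤ γ := by
    convert abs_le_dualNorm (fun a => f t a - Q t a) (pol p (xs t)) using 2
    simp only [hu, hv, Finset.sum_range_succ]
    ring
  have hpert (p : P) (z : X × Fin K → ℝ) : (∑ xc : X, dotp (pol p xc) fun j => z (xc, j)) =
      ∑ k : X × Fin K, if pol p k.1 k.2 then z k else 0 := by
    rw [Fintype.sum_prod_type]; rfl
  simp only [hpert]
  refine (integral_sub_le_of_disagreement_le (fun a => f t a - Q t a) _ _
    (c := ε * γ) (by positivity) fun j => ?_).trans ?_
  · refine (measure_mono fun z hz => ?_).trans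
      (laplacePi_disagreement_le hε huv (fun p k => pol p k.1 k.2) (xs t, j))
    exact ⟨_, _, hz,
      argminTie_le fun p => u p + ∑ k : X × Fin K, if pol p k.1 k.2 then z k else 0,
      argminTie_le fun p => v p + ∑ k : X × Fin K, if pol p k.1 k.2 then z k else 0⟩
  · nlinarith [show 0 ≤ ε * K * γ ^ 2 by positivity]
end
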